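/- arXiv:2012.13067 — 3 statements merged into one kernel-verified Lean document; each statement's English description precedes it below -/
import Mathlib

section
/- Let Ω ⊂ ℝⁿ be a nonempty bounded open set, T > 0, W ∈ ℝ^{n+k} a unit vector, and F₀ : Ω̄ → ℝ^{n+k} smooth. Let F : Ω̄ × [0,T) → ℝ^{n+k} be smooth, with each time slice F(·,t) a smooth immersion, satisfying the translating mean curvature flow (∂_t F)^⊥ = Δ_{g(t)} F + W^⊥ on Ω × (0,T) — where g(t) is the metric induced by F(·,t), Δ_{g(t)} is its Laplace–Beltrami operator applied componentwise, and ⊥ denotes orthogonal projection onto the orthogonal complement of span{∂_1F(·,t),…,∂_nF(·,t)} — together with F(x,0) = F₀(x) for x ∈ Ω̄ and F(x,t) = F₀(x) for x ∈ ∂Ω, t ∈ [0,T). Then for every component index α ∈ {1,…,n+k}: sup_{Ω × [0,T)} |F^α| ≤ sup_Ω |F₀^α| + 2|W^α| T. -/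
open Real MeasureTheory

noncomputable section

/-- Partial derivative of a scalar function in the `i`-th coordinate direction. -/
def pd {n : ℕ} (i : Fin n) (φ : (Fin n → ℝ) → ℝ) (x : Fin n → ℝ) : ℝ :=
  fderiv ℝ φ x (Pi.single i 1)

/-- Induced metric `g_{ij} = ⟨∂_i F, ∂_j F⟩`. -/
def gmat {n m : ℕ} (F : (Fin n → ℝ) → (Fin m → ℝ)) (x : Fin n → ℝ) :
    Matrix (Fin n) (Fin n) ℝ :=
  Matrix.of fun i j => ∑ a, pd i (fun y => F y a) x * pd j (fun y => F y a) x

/-- Inverse metric `g^{ij}`. -/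
def ginv {n m : ℕ} (F : (Fin n → ℝ) → (Fin m → ℝ)) (x : Fin n → ℝ) :
    Matrix (Fin n) (Fin n) ℝ :=
  (gmat F x)⁻¹

/-- Laplace–Beltrami operator `Δ_g φ = g^{-1/2} Σ_{i,j} ∂_i (g^{1/2} g^{ij} ∂_j φ)`. -/
def lapB {n m : ℕ} (F : (Fin n → ℝ) → (Fin m → ℝ)) (φ : (Fin n → ℝ) → ℝ)
    (x : Fin n → ℝ) : ℝ :=
  (Real.sqrt (gmat F x).det)⁻¹ *
    ∑ i, ∑ j, pd i (fun y => Real.sqrt (gmat F y).det * ginv F y i j * pd j φ y) x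

/-- Mean curvature vector `H̄ = Δ_g F` (componentwise). -/
def Hvec {n m : ℕ} (F : (Fin n → ℝ) → (Fin m → ℝ)) (x : Fin n → ℝ) : Fin m → ℝ :=
  fun a => lapB F (fun y => F y a) x

/-- Tangential projection of an ambient vector `V` onto `span{∂_1 F(x), …, ∂_n F(x)}`:
`V^⊤ = Σ_{i,j} g^{ij} ⟨V, ∂_j F⟩ ∂_i F`. -/
def tproj {n m : ℕ} (F : (Fin n → ℝ) → (Fin m → ℝ)) (x : Fin n → ℝ)
    (V : Fin m → ℝ) : Fin m → ℝ :=
  fun a => ∑ i, ∑ j, ginv F x i j * (∑ b, V b * pd j (fun y => F y b) x)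
      * pd i (fun y => F y a) x

/-- `S(x) = ⟨F(x), W⟩`. -/
def Sfun {n m : ℕ} (F : (Fin n → ℝ) → (Fin m → ℝ)) (W : Fin m → ℝ)
    (x : Fin n → ℝ) : ℝ :=
  ∑ a, F x a * W a

open Filter Topology Set in
theorem deriv_nonneg_of_isMaxOn_Icc {f : ℝ → ℝ} {s t : ℝ} (hst : s < t)
    (hf : DifferentiableAt ℝ f t) (hmax : ∀ r ∈ Icc s t, f r ≤ f t) : 0 ≤ deriv f t := by
  have hloc : IsLocalMaxOn f (Icc s t) t := by
    filter_upwards [self_mem_nhdsWithin] with r hr using hmax r hr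
  have hcone : s - t ∈ posTangentConeAt (Icc s t) t :=
    sub_mem_posTangentConeAt_of_segment_subset <|
      (convex_Icc s t).segment_subset (right_mem_Icc.2 hst.le) (left_mem_Icc.2 hst.le)
  have h := hloc.hasFDerivWithinAt_nonpos hf.hasDerivAt.hasFDerivAt.hasFDerivWithinAt hcone
  simp only [ContinuousLinearMap.toSpanSingleton_apply, smul_eq_mul] at h
  nlinarith

open Filter Topology in
theorem deriv_deriv_nonpos_of_isLocalMax {f : ℝ → ℝ} {a : ℝ} (h : IsLocalMax f a)
    (hc : ContinuousAt f a) : deriv (deriv f) a ≤ 0 := by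
  by_contra! hpos
  have hmin := isLocalMin_of_deriv_deriv_pos hpos h.deriv_eq_zero hc
  have hconst : f =ᶠ[𝓝 a] fun _ => f a := by
    filter_upwards [h, hmin] with y h₁ h₂ using le_antisymm h₁ h₂
  rw [hconst.deriv.deriv_eq] at hpos
  simp at hpos

open Filter Topology in
theorem fderiv_fderiv_nonpos_of_isLocalMax {E : Type*} [NormedAddCommGroup E] [NormedSpace ℝ E]
    {φ : E → ℝ} {x : E} (hφ : ContDiffAt ℝ 2 φ x) (h : IsLocalMax φ x) (v : E) :
    fderiv ℝ (fderiv ℝ φ) x v v ≤ 0 := by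
  have hline : ∀ s : ℝ, HasDerivAt (fun s : ℝ => x + s • v) v s := fun s => by
    simpa using ((hasDerivAt_id s).smul_const v).const_add x
  have htend : Tendsto (fun s : ℝ => x + s • v) (𝓝 0) (𝓝 x) := by
    simpa using (hline 0).continuousAt.tendsto
  have hmax : IsLocalMax (fun s : ℝ => φ (x + s • v)) 0 := by
    filter_upwards [htend.eventually h] with s hs
    simpa using hs
  have hdiff : ∀ᶠ y in 𝓝 x, DifferentiableAt ℝ φ y :=
    (hφ.eventually (by simp)).mono fun y hy => hy.differentiableAt (by simp)
  have hderiv : deriv (fun s : ℝ => φ (x + s • v)) =ᶠ[𝓝 0] fun s => fderiv ℝ φ (x + s • v) v := by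
    filter_upwards [htend.eventually hdiff] with s hs
    exact (hs.hasFDerivAt.comp_hasDerivAt s (hline s)).deriv
  have hd2 : HasFDerivAt (fderiv ℝ φ) (fderiv ℝ (fderiv ℝ φ) x) (x + (0 : ℝ) • v) := by
    rw [zero_smul, add_zero]
    exact ((hφ.fderiv_right (m := 1) (by norm_num)).differentiableAt one_ne_zero).hasFDerivAt
  have hsecond : HasDerivAt (fun s : ℝ => fderiv ℝ φ (x + s • v) v)
      (fderiv ℝ (fderiv ℝ φ) x v v) 0 := by
    have h1 : HasDerivAt (fun s : ℝ => fderiv ℝ φ (x + s • v)) (fderiv ℝ (fderiv ℝ φ) x v) 0 :=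
      hd2.comp_hasDerivAt (0 : ℝ) (hline 0)
    simpa using h1.clm_apply (hasDerivAt_const (0 : ℝ) v)
  have hcont : ContinuousAt (fun s : ℝ => φ (x + s • v)) 0 := by
    have h0 : ContinuousAt φ (x + (0 : ℝ) • v) := by simpa using hφ.continuousAt
    exact h0.comp (f := fun s : ℝ => x + s • v) (hline 0).continuousAt
  have := deriv_deriv_nonpos_of_isLocalMax hmax hcont
  rwa [hderiv.deriv_eq, hsecond.deriv] at this

/-- The trace pairing of a positive semidefinite matrix with a nonpositive form is nonpositive. -/
theorem sum_mul_nonpos_of_posSemidef {n : ℕ} {A : Matrix (Fin n) (Fin n) ℝ} (hA : A.PosSemidef)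
    (B : (Fin n → ℝ) →L[ℝ] (Fin n → ℝ) →L[ℝ] ℝ) (hB : ∀ v, B v v ≤ 0) :
    ∑ i, ∑ j, A i j * B (Pi.single i 1) (Pi.single j 1) ≤ 0 := by
  obtain ⟨m, v, rfl⟩ := Matrix.posSemidef_iff_eq_sum_vecMulVec.1 hA
  have hquad : ∀ w : Fin n → ℝ,
      B w w = ∑ i, ∑ j, w i * w j * B (Pi.single i 1) (Pi.single j 1) := fun w => by
    have hw : w = ∑ i, w i • (Pi.single i 1 : Fin n → ℝ) := by
      simpa using (Finset.univ_sum_single w).symm.trans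
        (Finset.sum_congr rfl fun i _ => by simp [← Pi.single_smul])
    conv_lhs => rw [hw]
    simp only [map_sum, map_smul, sum_apply, smul_apply,
      smul_eq_mul, Finset.mul_sum]
    rw [Finset.sum_comm]
    exact Finset.sum_congr rfl fun i _ => Finset.sum_congr rfl fun j _ => by ring
  have heq : ∑ i, ∑ j, (∑ l, Matrix.vecMulVec (v l) (star (v l))) i j
      * B (Pi.single i 1) (Pi.single j 1) = ∑ l, B (v l) (v l) := by
    simp only [hquad, Matrix.sum_apply, Matrix.vecMulVec_apply, star_trivial,
      Finset.sum_mul]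
    rw [Finset.sum_comm]
    simp only [Finset.sum_comm (s := (Finset.univ : Finset (Fin m)))]
    rw [Finset.sum_comm]
  rw [heq]
  exact Finset.sum_nonpos fun l _ => hB _

theorem hasFDerivAt_mul_of_eq_zero {E : Type*} [NormedAddCommGroup E] [NormedSpace ℝ E]
    {a b : E → ℝ} {x : E} (ha : ContinuousAt a x) (hb : DifferentiableAt ℝ b x) (hbx : b x = 0) :
    HasFDerivAt (fun y => a y * b y) (a x • fderiv ℝ b x) x := by
  have h₁ : HasFDerivAt (fun y => a x * b y) (a x • fderiv ℝ b x) x :=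
    hb.hasFDerivAt.const_mul (a x)
  have h₂ : HasFDerivAt (fun y => (a y - a x) * b y) (0 : E →L[ℝ] ℝ) x := by
    rw [hasFDerivAt_iff_isLittleO]
    have ho : (fun y => a y - a x) =o[nhds x] (fun _ => (1 : ℝ)) := by
      rw [Asymptotics.isLittleO_one_iff]
      simpa using ha.tendsto.sub_const (a x)
    have hO : b =O[nhds x] fun y => y - x := by
      simpa [hbx] using hb.isBigO_sub
    simpa [hbx] using ho.mul_isBigO hO.norm_right
  have h := h₁.fun_add h₂
  simp only [← add_mul, add_sub_cancel, add_zero] at h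
  exact h

section Operator

variable {n m : ℕ} {G : (Fin n → ℝ) → (Fin m → ℝ)} {x : Fin n → ℝ}

theorem differentiableAt_pd {φ : (Fin n → ℝ) → ℝ} (hφ : ContDiffAt ℝ 2 φ x) (i : Fin n) :
    DifferentiableAt ℝ (pd i φ) x :=
  ((hφ.fderiv_right (m := 1) (by norm_num)).differentiableAt (by simp)).clm_apply
    (differentiableAt_const _)

theorem continuousAt_gmat (hG : ∀ a, ContDiffAt ℝ 2 (fun y => G y a) x) :
    ContinuousAt (gmat G) x := by
  refine continuousAt_pi.2 fun i => continuousAt_pi.2 fun j => ?_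
  have hterm : ∀ a ∈ Finset.univ, ContinuousAt
      (fun y => pd i (fun z => G z a) y * pd j (fun z => G z a) y) x := fun a _ =>
    (differentiableAt_pd (hG a) i).continuousAt.mul (differentiableAt_pd (hG a) j).continuousAt
  exact tendsto_finsetSum _ hterm

theorem lapB_nonpos_of_isLocalMax (hG : ∀ a, ContDiffAt ℝ 2 (fun y => G y a) x)
    (hpos : (gmat G x).PosDef) {φ : (Fin n → ℝ) → ℝ} (hφ : ContDiffAt ℝ 2 φ x)
    (hmax : IsLocalMax φ x) : lapB G φ x ≤ 0 := by
  have hdet : ContinuousAt (fun y => (gmat G y).det) x :=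
    (continuous_id.matrix_det.continuousAt).comp (continuousAt_gmat hG)
  have hinv : ContinuousAt (ginv G) x := by
    refine ContinuousAt.comp (g := Inv.inv) (continuousAt_matrix_inv _ ?_) (continuousAt_gmat hG)
    simpa using continuousAt_inv₀ hpos.det_pos.ne'
  have hcoef : ∀ i j, ContinuousAt (fun y => √(gmat G y).det * ginv G y i j) x := fun i j =>
    hdet.sqrt.mul (continuousAt_pi.1 (continuousAt_pi.1 hinv i) j)
  have hterm : ∀ i j, pd i (fun y => √(gmat G y).det * ginv G y i j * pd j φ y) x
      = √(gmat G x).det *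
        (ginv G x i j * fderiv ℝ (fderiv ℝ φ) x (Pi.single i 1) (Pi.single j 1)) := fun i j => by
    have hd : HasFDerivAt (fderiv ℝ φ) (fderiv ℝ (fderiv ℝ φ) x) x :=
      ((hφ.fderiv_right (m := 1) (by norm_num)).differentiableAt (by simp)).hasFDerivAt
    have h0 : pd j φ x = 0 := by simp [pd, hmax.fderiv_eq_zero]
    rw [pd, (hasFDerivAt_mul_of_eq_zero (hcoef i j) (differentiableAt_pd hφ j) h0).fderiv]
    have hpd : fderiv ℝ (pd j φ) x
        = (fderiv ℝ (fderiv ℝ φ) x).flip (Pi.single j 1) := by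
      have h := (hd.clm_apply (hasFDerivAt_const (Pi.single j 1 : Fin n → ℝ) x)).fderiv
      simp only [ContinuousLinearMap.comp_zero, zero_add] at h
      exact h
    simp [hpd, mul_assoc]
  simp only [lapB, hterm, ← Finset.mul_sum]
  refine mul_nonpos_of_nonneg_of_nonpos (by positivity)
    (mul_nonpos_of_nonneg_of_nonpos (by positivity) ?_)
  exact sum_mul_nonpos_of_posSemidef hpos.inv.posSemidef _
    (fderiv_fderiv_nonpos_of_isLocalMax hφ hmax)

theorem pd_neg (i : Fin n) (φ : (Fin n → ℝ) → ℝ) : pd i (fun y => -φ y) x = -pd i φ x := by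
  simp [pd, fderiv_fun_neg]

theorem lapB_neg (φ : (Fin n → ℝ) → ℝ) : lapB G (fun y => -φ y) x = -lapB G φ x := by
  simp only [lapB, pd_neg, mul_neg, Finset.sum_neg_distrib]

theorem lapB_nonneg_of_isLocalMin (hG : ∀ a, ContDiffAt ℝ 2 (fun y => G y a) x)
    (hpos : (gmat G x).PosDef) {φ : (Fin n → ℝ) → ℝ} (hφ : ContDiffAt ℝ 2 φ x)
    (hmin : IsLocalMin φ x) : 0 ≤ lapB G φ x := by
  have := lapB_nonpos_of_isLocalMax hG hpos hφ.neg hmin.neg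
  rw [lapB_neg] at this
  linarith

theorem tproj_eq_zero_of_fderiv_eq_zero {a : Fin m} (h : fderiv ℝ (fun y => G y a) x = 0)
    (V : Fin m → ℝ) : tproj G x V a = 0 := by
  simp [tproj, pd, h]

end Operator

open Set Topology in
/-- A parabolic maximum principle: if at every interior spatial maximum the time derivative is at
most `c ≥ 0`, then `u` grows at most linearly with slope `c` over its parabolic boundary values. -/
theorem le_add_mul_of_deriv_le_at_isLocalMax {X : Type*} [PseudoMetricSpace X] [ProperSpace X]
    {Ω : Set X} (hΩo : IsOpen Ω) (hΩb : Bornology.IsBounded Ω) {T c C : ℝ} (hc : 0 ≤ c)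
    {u : X → ℝ → ℝ}
    (hu : ContinuousOn (fun p : X × ℝ => u p.1 p.2) (closure Ω ×ˢ Ico 0 T))
    (hdiff : ∀ x ∈ Ω, ∀ t ∈ Ioo 0 T, DifferentiableAt ℝ (u x) t)
    (hder : ∀ x ∈ Ω, ∀ t ∈ Ioo 0 T, IsLocalMax (fun y => u y t) x → deriv (u x) t ≤ c)
    (hinit : ∀ x ∈ closure Ω, u x 0 ≤ C)
    (hbdry : ∀ x ∈ frontier Ω, ∀ t ∈ Ico 0 T, u x t ≤ C) :
    ∀ x ∈ Ω, ∀ t ∈ Ico 0 T, u x t ≤ C + c * t := by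
  intro x hx t ht
  have key : ∀ ε > 0, u x t ≤ C + (c + ε) * t := by
    intro ε hε
    have hK : IsCompact (closure Ω ×ˢ Icc 0 t) := hΩb.isCompact_closure.prod isCompact_Icc
    have hxK : (x, t) ∈ closure Ω ×ˢ Icc 0 t := ⟨subset_closure hx, ht.1, le_rfl⟩
    have hcont : ContinuousOn (fun p : X × ℝ => u p.1 p.2 - (c + ε) * p.2)
        (closure Ω ×ˢ Icc 0 t) :=
      (hu.mono (prod_mono_right fun s hs => ⟨hs.1, hs.2.trans_lt ht.2⟩)).sub (by fun_prop)
    obtain ⟨⟨x₀, t₀⟩, ⟨hx₀, ht₀⟩, hmax⟩ := hK.exists_isMaxOn ⟨_, hxK⟩ hcont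
    have hle : ∀ y ∈ closure Ω, ∀ s ∈ Icc 0 t,
        u y s - (c + ε) * s ≤ u x₀ t₀ - (c + ε) * t₀ := fun y hy s hs =>
      hmax (mk_mem_prod hy hs)
    simp only at hx₀ ht₀
    suffices u x₀ t₀ - (c + ε) * t₀ ≤ C by
      linarith [hle x (subset_closure hx) t ⟨ht.1, le_rfl⟩]
    have hnn : 0 ≤ (c + ε) * t₀ := mul_nonneg (by positivity) ht₀.1
    rcases ht₀.1.eq_or_lt with h0 | h0
    · rw [← h0]
      simpa using hinit x₀ hx₀
    have ht₀T : t₀ < T := ht₀.2.trans_lt ht.2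
    by_cases hxΩ : x₀ ∈ Ω
    · exfalso
      have hsp : IsLocalMax (fun y => u y t₀) x₀ := by
        filter_upwards [hΩo.mem_nhds hxΩ] with y hy
        linarith [hle y (subset_closure hy) t₀ ht₀]
      have hd := hdiff x₀ hxΩ t₀ ⟨h0, ht₀T⟩
      have hv : HasDerivAt (fun s => u x₀ s - (c + ε) * s) (deriv (u x₀) t₀ - (c + ε)) t₀ := by
        simpa using hd.hasDerivAt.fun_sub ((hasDerivAt_id t₀).const_mul (c + ε))
      have h1 := deriv_nonneg_of_isMaxOn_Icc h0 hv.differentiableAt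
        fun r hr => hle x₀ hx₀ r ⟨hr.1, hr.2.trans ht₀.2⟩
      rw [hv.deriv] at h1
      linarith [hder x₀ hxΩ t₀ ⟨h0, ht₀T⟩ hsp]
    · have hfr : x₀ ∈ frontier Ω := by
        rw [hΩo.frontier_eq]
        exact ⟨hx₀, hxΩ⟩
      linarith [hbdry x₀ hfr t₀ ⟨h0.le, ht₀T⟩]
  refine le_of_forall_pos_le_add fun ε hε => ?_
  have hT : 0 < 1 + t := by linarith [ht.1]
  have h := key (ε / (1 + t)) (div_pos hε hT)
  have : ε / (1 + t) * t ≤ ε := by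
    rw [div_mul_eq_mul_div, div_le_iff₀ hT]
    nlinarith
  linarith

/-- Maximum-principle bound for the components of a translating mean
curvature flow with Dirichlet initial–boundary data `F₀`. -/
theorem tmcf_component_bound {n k : ℕ} (hn : 1 ≤ n) (hk : 1 ≤ k)
    (Ω : Set (Fin n → ℝ)) (hΩo : IsOpen Ω) (hΩne : Ω.Nonempty)
    (hΩb : Bornology.IsBounded Ω) (T : ℝ) (hT : 0 < T)
    (W : Fin (n + k) → ℝ) (hW : ∑ a, (W a) ^ 2 = 1)
    (F₀ : (Fin n → ℝ) → (Fin (n + k) → ℝ)) (hF₀ : ContDiffOn ℝ (⊤ : ℕ∞) F₀ (closure Ω))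
    (F : (Fin n → ℝ) → ℝ → (Fin (n + k) → ℝ))
    (hFsm : ContDiffOn ℝ (⊤ : ℕ∞) (fun p : (Fin n → ℝ) × ℝ => F p.1 p.2)
      (closure Ω ×ˢ Set.Ico 0 T))
    (himm : ∀ t ∈ Set.Ico (0 : ℝ) T, ∀ x ∈ Ω, (gmat (fun y => F y t) x).PosDef)
    (hflow : ∀ x ∈ Ω, ∀ t ∈ Set.Ioo (0 : ℝ) T, ∀ a,
      deriv (fun s => F x s a) t
          - tproj (fun y => F y t) x (fun b => deriv (fun s => F x s b) t) a
        = Hvec (fun y => F y t) x a + (W a - tproj (fun y => F y t) x W a))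
    (hinit : ∀ x ∈ closure Ω, F x 0 = F₀ x)
    (hbdry : ∀ x ∈ frontier Ω, ∀ t ∈ Set.Ico (0 : ℝ) T, F x t = F₀ x) :
    ∀ α : Fin (n + k), ∀ C : ℝ, (∀ y ∈ Ω, |F₀ y α| ≤ C) →
      ∀ x ∈ Ω, ∀ t ∈ Set.Ico (0 : ℝ) T, |F x t α| ≤ C + 2 * |W α| * T := by
  intro α C hC x hx t ht
  have hCcl : ∀ y ∈ closure Ω, |F₀ y α| ≤ C := fun y hy => by
    have hcont : ContinuousOn (fun y => |F₀ y α|) (closure Ω) :=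
      ((continuous_apply α).comp_continuousOn hF₀.continuousOn).abs
    exact le_on_closure hC hcont continuousOn_const hy
  have hsm : ∀ a, ContDiffOn ℝ (⊤ : ℕ∞) (fun p : (Fin n → ℝ) × ℝ => F p.1 p.2 a)
      (closure Ω ×ˢ Set.Ico 0 T) := fun a => contDiffOn_pi.1 hFsm a
  have hat : ∀ a, ∀ y ∈ Ω, ∀ s ∈ Set.Ioo (0 : ℝ) T,
      ContDiffAt ℝ 2 (fun p : (Fin n → ℝ) × ℝ => F p.1 p.2 a) (y, s) := fun a y hy s hs =>
    ((hsm a).contDiffAt (prod_mem_nhds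
      (Filter.mem_of_superset (hΩo.mem_nhds hy) subset_closure)
      (Filter.mem_of_superset (Ioo_mem_nhds hs.1 hs.2) Set.Ioo_subset_Ico_self))).of_le
      (by exact WithTop.coe_le_coe.2 le_top)
  have hspace : ∀ y ∈ Ω, ∀ s ∈ Set.Ioo (0 : ℝ) T, ∀ a,
      ContDiffAt ℝ 2 (fun z => F z s a) y := fun y hy s hs a =>
    ContDiffAt.comp (f := fun z => (z, s)) y (hat a y hy s hs)
      (contDiffAt_id.prodMk contDiffAt_const)
  have htime : ∀ y ∈ Ω, ∀ s ∈ Set.Ioo (0 : ℝ) T,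
      DifferentiableAt ℝ (fun r => F y r α) s := fun y hy s hs =>
    (ContDiffAt.comp (f := fun r => (y, r)) s (hat α y hy s hs)
      (contDiffAt_const.prodMk contDiffAt_id)).differentiableAt (by simp)
  have hcrit : ∀ y ∈ Ω, ∀ s ∈ Set.Ioo (0 : ℝ) T, fderiv ℝ (fun z => F z s α) y = 0 →
      deriv (fun r => F y r α) s = lapB (fun z => F z s) (fun z => F z s α) y + W α := by
    intro y hy s hs h0
    simpa [tproj_eq_zero_of_fderiv_eq_zero (G := fun z => F z s) h0, Hvec] using hflow y hy s hs α
  have hupper := le_add_mul_of_deriv_le_at_isLocalMax (u := fun y s => F y s α) (C := C)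
    hΩo hΩb (abs_nonneg (W α)) (hsm α).continuousOn htime
    (fun y hy s hs hmax => by
      rw [hcrit y hy s hs hmax.fderiv_eq_zero]
      linarith [lapB_nonpos_of_isLocalMax (hspace y hy s hs)
        (himm s (Set.Ioo_subset_Ico_self hs) y hy) (hspace y hy s hs α) hmax, le_abs_self (W α)])
    (fun y hy => by simpa [hinit y hy] using (abs_le.1 (hCcl y hy)).2)
    (fun y hy s hs => by
      simpa [hbdry y hy s hs] using (abs_le.1 (hCcl y (frontier_subset_closure hy))).2) x hx t ht
  have hlower := le_add_mul_of_deriv_le_at_isLocalMax (u := fun y s => -F y s α) (C := C)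
    hΩo hΩb (abs_nonneg (W α)) (hsm α).continuousOn.neg (fun y hy s hs => (htime y hy s hs).neg)
    (fun y hy s hs hmax => by
      have hmin : IsLocalMin (fun z => F z s α) y := by simpa using hmax.neg
      rw [deriv.fun_neg, hcrit y hy s hs hmin.fderiv_eq_zero]
      linarith [lapB_nonneg_of_isLocalMin (hspace y hy s hs)
        (himm s (Set.Ioo_subset_Ico_self hs) y hy) (hspace y hy s hs α) hmin, neg_abs_le (W α)])
    (fun y hy => by
      have := (abs_le.1 (hCcl y hy)).1
      simp only [hinit y hy]
      linarith)
    (fun y hy s hs => by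
      have := (abs_le.1 (hCcl y (frontier_subset_closure hy))).1
      simp only [hbdry y hy s hs]
      linarith) x hx t ht
  have hWt : |W α| * t ≤ 2 * |W α| * T := by
    nlinarith [abs_nonneg (W α), mul_le_mul_of_nonneg_left ht.2.le (abs_nonneg (W α)),
      mul_nonneg (abs_nonneg (W α)) hT.le]
  rw [abs_le]
  constructor <;> linarith
end
end

section
/- Let f : Ω̄ × [0,T) → ℝᵏ be a graphical translating mean curvature flow with initial–boundary data ψ and velocity vector w ∈ ℝᵏ. Then for every component index α ∈ {1,…,k}: (i) sup_{Ω × [0,T)} |f^α(x,t) − t w^α| ≤ max( sup_Ω |ψ^α|, sup_{x ∈ ∂Ω, t ∈ (0,T)} |ψ^α(x) − t w^α| ), and (ii) sup_{Ω × [0,T)} |f^α| ≤ sup_Ω |ψ^α| + 2 |w^α| T. -/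
open Real MeasureTheory

noncomputable section

/-- Partial derivative within a set (used at boundary points). -/
def pdW {n : ℕ} (s : Set (Fin n → ℝ)) (i : Fin n) (φ : (Fin n → ℝ) → ℝ)
    (x : Fin n → ℝ) : ℝ :=
  fderivWithin ℝ φ s x (Pi.single i 1)

/-- Induced metric of the graph of `f(·,t)`: `g_{ij} = δ_{ij} + ⟨∂_i f, ∂_j f⟩`. -/
def ggr {n k : ℕ} (f : (Fin n → ℝ) → ℝ → (Fin k → ℝ)) (t : ℝ) (x : Fin n → ℝ) :
    Matrix (Fin n) (Fin n) ℝ :=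
  Matrix.of fun i j =>
    (if i = j then (1 : ℝ) else 0) +
      ∑ a, pd i (fun y => f y t a) x * pd j (fun y => f y t a) x

/-- `f : Ω̄ × [0,T) → ℝᵏ` is a graphical translating mean curvature flow with
initial–boundary data `ψ` and velocity vector `w`. -/
def IsGraphFlow {n k : ℕ} (Ω : Set (Fin n → ℝ)) (T : ℝ) (w : Fin k → ℝ)
    (ψ : (Fin n → ℝ) → (Fin k → ℝ)) (f : (Fin n → ℝ) → ℝ → (Fin k → ℝ)) : Prop :=
  ContDiffOn ℝ (⊤ : ℕ∞) (fun p : (Fin n → ℝ) × ℝ => f p.1 p.2) (closure Ω ×ˢ Set.Ico 0 T) ∧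
  (∀ x ∈ Ω, ∀ t ∈ Set.Ioo 0 T, ∀ a,
      deriv (fun s => f x s a) t =
        (∑ i, ∑ j, (ggr f t x)⁻¹ i j * pd i (fun y => pd j (fun z => f z t a) y) x)
          + w a) ∧
  (∀ x ∈ closure Ω, f x 0 = ψ x) ∧
  (∀ x ∈ frontier Ω, ∀ t ∈ Set.Ico 0 T, f x t = ψ x)

/-- At a local maximum, the second derivative is a nonpositive quadratic form. -/
theorem IsLocalMax.fderiv_fderiv_self_nonpos {E : Type*} [NormedAddCommGroup E] [NormedSpace ℝ E]
    {φ : E → ℝ} {x : E} (hφ : ContDiffAt ℝ 2 φ x) (hmax : IsLocalMax φ x) (v : E) :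
    fderiv ℝ (fderiv ℝ φ) x v v ≤ 0 := by
  have hline : ∀ s : ℝ, HasDerivAt (fun s : ℝ => x + s • v) v s := fun s => by
    simpa using ((hasDerivAt_id s).smul_const v).const_add x
  have hcont : Filter.Tendsto (fun s : ℝ => x + s • v) (nhds 0) (nhds x) := by
    simpa using (hline 0).continuousAt.tendsto
  have hd : ∀ᶠ s : ℝ in nhds 0,
      HasDerivAt (fun s : ℝ => φ (x + s • v)) (fderiv ℝ φ (x + s • v) v) s := by
    have hev : ∀ᶠ y in nhds x, DifferentiableAt ℝ φ y :=
      (hφ.eventually (by simp)).mono fun y hy => hy.differentiableAt (by simp)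
    filter_upwards [hcont.eventually hev] with s hs
    exact hs.hasFDerivAt.comp_hasDerivAt s (hline s)
  have hderiv : deriv (fun s : ℝ => φ (x + s • v)) =ᶠ[nhds 0]
      fun s => fderiv ℝ φ (x + s • v) v := hd.mono fun s hs => hs.deriv
  have h2 : HasFDerivAt (fderiv ℝ φ) (fderiv ℝ (fderiv ℝ φ) x) (x + (0 : ℝ) • v) := by
    simpa using ((hφ.fderiv_right (m := 1) (by norm_num)).differentiableAt (by simp)).hasFDerivAt
  have hdd : deriv (deriv fun s : ℝ => φ (x + s • v)) 0 = fderiv ℝ (fderiv ℝ φ) x v v := by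
    rw [hderiv.deriv_eq]
    have h3 : HasDerivAt (fun s : ℝ => fderiv ℝ φ (x + s • v)) (fderiv ℝ (fderiv ℝ φ) x v) 0 :=
      h2.comp_hasDerivAt 0 (hline 0)
    simpa using (h3.clm_apply (hasDerivAt_const (0 : ℝ) v)).deriv
  have hmax' : IsLocalMax (fun s : ℝ => φ (x + s • v)) 0 := by
    have := hcont.eventually hmax
    filter_upwards [this] with s hs
    simpa using hs
  by_contra! hpos
  have hmin := isLocalMin_of_deriv_deriv_pos (hdd ▸ hpos) hmax'.deriv_eq_zero
    hd.self_of_nhds.continuousAt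
  have hc : (fun s : ℝ => φ (x + s • v)) =ᶠ[nhds 0] fun _ => φ (x + (0 : ℝ) • v) := by
    filter_upwards [hmax', hmin] with s h1 h2 using le_antisymm h1 h2
  have := hc.deriv.deriv_eq
  simp [hdd] at this
  linarith

theorem sum_mul_pd_pd {n : ℕ} {φ : (Fin n → ℝ) → ℝ} {x : Fin n → ℝ}
    (hφ : ContDiffAt ℝ 2 φ x) (v : Fin n → ℝ) :
    ∑ i, ∑ j, v i * v j * pd i (fun y => pd j φ y) x = fderiv ℝ (fderiv ℝ φ) x v v := by
  have hd : DifferentiableAt ℝ (fderiv ℝ φ) x :=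
    (hφ.fderiv_right (m := 1) (by norm_num)).differentiableAt (by simp)
  have hpd : ∀ i j, pd i (fun y => pd j φ y) x
      = fderiv ℝ (fderiv ℝ φ) x (Pi.single i 1) (Pi.single j 1) := fun i j => by
    unfold pd
    rw [fderiv_clm_apply hd (differentiableAt_const _)]
    simp
  have hv : v = ∑ i, v i • (Pi.single i 1 : Fin n → ℝ) := pi_eq_sum_univ' v
  conv_rhs => rw [hv]
  simp only [hpd, map_sum, map_smul, _root_.sum_apply, _root_.smul_apply,
    smul_eq_mul, Finset.mul_sum]
  rw [Finset.sum_comm]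
  exact Finset.sum_congr rfl fun i _ => Finset.sum_congr rfl fun j _ => by ring

open scoped MatrixOrder Matrix.Norms.L2Operator in
theorem Matrix.PosSemidef.exists_eq_conjTranspose_mul_self {n : ℕ} {A : Matrix (Fin n) (Fin n) ℝ}
    (hA : A.PosSemidef) : ∃ B : Matrix (Fin n) (Fin n) ℝ, A = B.conjTranspose * B :=
  CStarAlgebra.nonneg_iff_eq_star_mul_self.mp hA.nonneg

theorem IsLocalMax.sum_posSemidef_mul_pd_pd_nonpos {n : ℕ} {φ : (Fin n → ℝ) → ℝ} {x : Fin n → ℝ}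
    (hφ : ContDiffAt ℝ 2 φ x) (hmax : IsLocalMax φ x) {A : Matrix (Fin n) (Fin n) ℝ}
    (hA : A.PosSemidef) :
    ∑ i, ∑ j, A i j * pd i (fun y => pd j φ y) x ≤ 0 := by
  obtain ⟨B, rfl⟩ := hA.exists_eq_conjTranspose_mul_self
  have : ∑ i, ∑ j, (B.conjTranspose * B) i j * pd i (fun y => pd j φ y) x
      = ∑ l, ∑ i, ∑ j, B l i * B l j * pd i (fun y => pd j φ y) x := by
    simp only [Matrix.mul_apply, Matrix.conjTranspose_apply, star_trivial, Finset.sum_mul]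
    conv_rhs => rw [Finset.sum_comm]
    exact Finset.sum_congr rfl fun i _ => Finset.sum_comm
  rw [this]
  exact Finset.sum_nonpos fun l _ =>
    (sum_mul_pd_pd hφ (B l)).trans_le (hmax.fderiv_fderiv_self_nonpos hφ (B l))

theorem ggr_posSemidef {n k : ℕ} (f : (Fin n → ℝ) → ℝ → (Fin k → ℝ)) (t : ℝ) (x : Fin n → ℝ) :
    (ggr f t x).PosSemidef := by
  have : ggr f t x = 1 + ∑ a, Matrix.vecMulVec (fun i => pd i (fun y => f y t a) x)
      (star fun i => pd i (fun y => f y t a) x) := by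
    ext i j
    simp [ggr, Matrix.one_apply, Matrix.sum_apply, Matrix.vecMulVec_apply]
  rw [this]
  exact Matrix.PosSemidef.one.add
    (Matrix.posSemidef_sum _ fun a _ => Matrix.posSemidef_vecMulVec_self_star _)

/-- The parabolic weak maximum principle on a bounded cylinder, for a degenerate elliptic operator
in nondivergence form. -/
theorem parabolic_weak_maximum_principle {n : ℕ} {Ω : Set (Fin n → ℝ)} (hΩo : IsOpen Ω)
    (hΩb : Bornology.IsBounded Ω) {T C : ℝ} {u : (Fin n → ℝ) → ℝ → ℝ}
    {A : (Fin n → ℝ) → ℝ → Matrix (Fin n) (Fin n) ℝ}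
    (hA : ∀ x t, (A x t).PosSemidef)
    (hu : ContDiffOn ℝ 2 (fun p : (Fin n → ℝ) × ℝ => u p.1 p.2) (closure Ω ×ˢ Set.Ico 0 T))
    (heq : ∀ x ∈ Ω, ∀ t ∈ Set.Ioo 0 T,
      deriv (u x) t ≤ ∑ i, ∑ j, A x t i j * pd i (fun y => pd j (fun z => u z t) y) x)
    (h0 : ∀ x ∈ closure Ω, u x 0 ≤ C)
    (hb : ∀ x ∈ frontier Ω, ∀ t ∈ Set.Ioo 0 T, u x t ≤ C) :
    ∀ x ∈ Ω, ∀ t ∈ Set.Ico 0 T, u x t ≤ C := by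
  intro x hx t ht
  refine le_of_forall_pos_le_add fun δ hδ => ?_
  obtain ⟨ε, hε, hεδ⟩ : ∃ ε > 0, ε * t ≤ δ :=
    ⟨δ / (t + 1), by have := ht.1; positivity, by
      have := ht.1
      rw [div_mul_eq_mul_div, div_le_iff₀ (by linarith)]; nlinarith⟩
  have hK : IsCompact (closure Ω ×ˢ Set.Icc 0 t) := hΩb.isCompact_closure.prod isCompact_Icc
  have hsub : closure Ω ×ˢ Set.Icc 0 t ⊆ closure Ω ×ˢ Set.Ico 0 T :=
    Set.prod_mono_right fun s hs => ⟨hs.1, hs.2.trans_lt ht.2⟩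
  obtain ⟨⟨y, s⟩, ⟨hy, hs⟩, hmax⟩ := hK.exists_isMaxOn
    ⟨(x, t), subset_closure hx, Set.right_mem_Icc.2 ht.1⟩
    ((hu.continuousOn.mono hsub).sub
      (continuous_const.mul continuous_snd : Continuous fun p : (Fin n → ℝ) × ℝ => ε * p.2).continuousOn)
  simp only at hy hs
  have hmax' : ∀ z ∈ closure Ω, ∀ r ∈ Set.Icc 0 t, u z r - ε * r ≤ u y s - ε * s :=
    fun z hz r hr => hmax (show (z, r) ∈ closure Ω ×ˢ Set.Icc 0 t from ⟨hz, hr⟩)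
  suffices u y s ≤ C by
    have h1 := hmax' x (subset_closure hx) t (Set.right_mem_Icc.2 ht.1)
    have h2 := mul_nonneg hε.le hs.1
    linarith
  rcases hs.1.eq_or_lt with rfl | hs0
  · exact h0 y hy
  have hsT : s ∈ Set.Ioo 0 T := ⟨hs0, hs.2.trans_lt ht.2⟩
  by_cases hyΩ : y ∉ Ω
  · exact hb y ⟨hy, by rwa [hΩo.interior_eq]⟩ s hsT
  rw [not_not] at hyΩ
  exfalso
  have hcd : ContDiffAt ℝ 2 (fun p : (Fin n → ℝ) × ℝ => u p.1 p.2) (y, s) :=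
    hu.contDiffAt (prod_mem_nhds (Filter.mem_of_superset (hΩo.mem_nhds hyΩ) subset_closure)
      (Ico_mem_nhds hsT.1 hsT.2))
  have hcx : ContDiffAt ℝ 2 (fun z => u z s) y :=
    ContDiffAt.comp (f := fun z => (z, s)) y hcd (contDiffAt_id.prodMk contDiffAt_const)
  have hct : ContDiffAt ℝ 2 (u y) s :=
    ContDiffAt.comp (f := fun r => (y, r)) s hcd (contDiffAt_const.prodMk contDiffAt_id)
  have hlm : IsLocalMax (fun z => u z s) y := by
    filter_upwards [hΩo.mem_nhds hyΩ] with z hz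
    have := hmax' z (subset_closure hz) s hs
    linarith
  have hspace := (heq y hyΩ s hsT).trans (hlm.sum_posSemidef_mul_pd_pd_nonpos hcx (hA y s))
  have htime : HasDerivAt (fun r => u y r - ε * r) (deriv (u y) s - ε) s := by
    have := (hct.differentiableAt (by simp)).hasDerivAt.sub ((hasDerivAt_id s).const_mul ε)
    rwa [mul_one] at this
  have hlt : IsLocalMaxOn (fun r => u y r - ε * r) (Set.Icc 0 s) s :=
    IsMaxOn.localize fun r hr => hmax' y hy r ⟨hr.1, hr.2.trans hs.2⟩
  have := hlt.hasFDerivWithinAt_nonpos htime.hasFDerivAt.hasFDerivWithinAt (y := -s)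
    (mem_posTangentConeAt_of_segment_subset (by
      rw [segment_symm, segment_eq_Icc (by linarith)]; simp))
  simp at this
  nlinarith

theorem IsGraphFlow.abs_sub_le {n k : ℕ} {Ω : Set (Fin n → ℝ)} (hΩo : IsOpen Ω)
    (hΩb : Bornology.IsBounded Ω) {T : ℝ} {w : Fin k → ℝ} {ψ : (Fin n → ℝ) → (Fin k → ℝ)}
    {f : (Fin n → ℝ) → ℝ → (Fin k → ℝ)} (hflow : IsGraphFlow Ω T w ψ f) {α : Fin k} {C : ℝ}
    (h0 : ∀ y ∈ closure Ω, |ψ y α| ≤ C)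
    (hb : ∀ y ∈ frontier Ω, ∀ s ∈ Set.Ioo (0 : ℝ) T, |ψ y α - s * w α| ≤ C) :
    ∀ x ∈ Ω, ∀ t ∈ Set.Ico (0 : ℝ) T, |f x t α - t * w α| ≤ C := by
  obtain ⟨hsm, hpde, hinit, hbd⟩ := hflow
  have key : ∀ σ : ℝ, |σ| = 1 → ∀ x ∈ Ω, ∀ t ∈ Set.Ico (0 : ℝ) T,
      σ * (f x t α - t * w α) ≤ C := by
    intro σ hσ
    refine parabolic_weak_maximum_principle hΩo hΩb (u := fun x t => σ * (f x t α - t * w α))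
      (A := fun x t => (ggr f t x)⁻¹) (fun x t => (ggr_posSemidef f t x).inv) ?_ ?_ ?_ ?_
    · have h1 : ContDiffOn ℝ 2 (fun p : (Fin n → ℝ) × ℝ => f p.1 p.2 α)
          (closure Ω ×ˢ Set.Ico 0 T) :=
        contDiffOn_pi.1 (hsm.of_le (WithTop.coe_le_coe.2 le_top)) α
      exact contDiffOn_const.mul (h1.sub (contDiff_snd.contDiffOn.mul contDiffOn_const))
    · intro x hx t ht
      have hcd : ContDiffAt ℝ (⊤ : ℕ∞) (fun p : (Fin n → ℝ) × ℝ => f p.1 p.2) (x, t) :=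
        hsm.contDiffAt (prod_mem_nhds (Filter.mem_of_superset (hΩo.mem_nhds hx) subset_closure)
          (Ico_mem_nhds ht.1 ht.2))
      have hct : DifferentiableAt ℝ (fun s => f x s α) t :=
        (contDiffAt_pi.1 (ContDiffAt.comp (f := fun r => (x, r)) t hcd
          (contDiffAt_const.prodMk contDiffAt_id)) α).differentiableAt (by simp)
      have hd : deriv (fun s => σ * (f x s α - s * w α)) t
          = σ * (deriv (fun s => f x s α) t - w α) := by
        simpa using ((hct.hasDerivAt.sub ((hasDerivAt_id t).mul_const (w α))).const_mul σ).deriv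
      have hpd2 : ∀ (i : Fin n) (φ : (Fin n → ℝ) → ℝ) y, pd i (fun z => σ * φ z) y
          = σ * pd i φ y := fun i φ y => by
        have := congrFun (fderiv_const_smul_field (𝕜 := ℝ) (f := φ) σ) y
        exact congrArg (fun L : (Fin n → ℝ) →L[ℝ] ℝ => L (Pi.single i 1)) this
      have hpd1 : ∀ j y, pd j (fun z => σ * (f z t α - t * w α)) y
          = σ * pd j (fun z => f z t α) y := fun j y => by
        rw [hpd2, pd, fderiv_sub_const, pd]
      rw [hd, hpde x hx t ht α]
      simp only [hpd1, hpd2]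
      simp only [add_sub_cancel_right, Finset.mul_sum]
      exact (Finset.sum_congr rfl fun i _ => Finset.sum_congr rfl fun j _ => by ring).le
    · intro x hx
      rw [hinit x hx]
      simpa [abs_mul, hσ] using (le_abs_self _).trans ((abs_mul σ _).trans_le
        (by rw [hσ, one_mul]; exact h0 x hx))
    · intro x hx t ht
      rw [hbd x hx t ⟨ht.1.le, ht.2⟩]
      exact (le_abs_self _).trans ((abs_mul σ _).trans_le
        (by rw [hσ, one_mul]; exact hb x hx t ht))
  intro x hx t ht
  have h1 := key 1 (by simp) x hx t ht
  have h2 := key (-1) (by simp) x hx t ht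
  exact abs_le.2 ⟨by linarith, by linarith⟩

/-- Maximum-principle bounds for the components of a graphical
translating mean curvature flow with initial–boundary data `ψ`. -/
theorem graph_flow_component_bounds {n k : ℕ} (hn : 1 ≤ n) (hk : 1 ≤ k)
    (Ω : Set (Fin n → ℝ)) (hΩo : IsOpen Ω) (hΩne : Ω.Nonempty)
    (hΩb : Bornology.IsBounded Ω) (T : ℝ) (hT : 0 < T)
    (w : Fin k → ℝ) (ψ : (Fin n → ℝ) → (Fin k → ℝ))
    (hψ : ContDiffOn ℝ (⊤ : ℕ∞) ψ (closure Ω))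
    (f : (Fin n → ℝ) → ℝ → (Fin k → ℝ)) (hflow : IsGraphFlow Ω T w ψ f) :
    ∀ α : Fin k,
      ((∀ C : ℝ, (∀ y ∈ Ω, |ψ y α| ≤ C) →
          (∀ y ∈ frontier Ω, ∀ s ∈ Set.Ioo (0 : ℝ) T, |ψ y α - s * w α| ≤ C) →
          ∀ x ∈ Ω, ∀ t ∈ Set.Ico (0 : ℝ) T, |f x t α - t * w α| ≤ C) ∧
        (∀ C : ℝ, (∀ y ∈ Ω, |ψ y α| ≤ C) →
          ∀ x ∈ Ω, ∀ t ∈ Set.Ico (0 : ℝ) T, |f x t α| ≤ C + 2 * |w α| * T)) := by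
  intro α
  have hcl : ∀ C : ℝ, (∀ y ∈ Ω, |ψ y α| ≤ C) → ∀ y ∈ closure Ω, |ψ y α| ≤ C := fun C hC y hy =>
    le_on_closure hC ((continuousOn_pi.1 hψ.continuousOn α).abs) continuousOn_const hy
  refine ⟨fun C hC hb => hflow.abs_sub_le hΩo hΩb (hcl C hC) hb, fun C hC x hx t ht => ?_⟩
  have htw : ∀ s ∈ Set.Ico (0 : ℝ) T, |s * w α| ≤ |w α| * T := fun s hs => by
    rw [abs_mul, abs_of_nonneg hs.1, mul_comm]
    exact mul_le_mul_of_nonneg_left hs.2.le (abs_nonneg _)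
  have hwT : 0 ≤ |w α| * T := by positivity
  have h := hflow.abs_sub_le hΩo hΩb (α := α) (C := C + |w α| * T)
    (fun y hy => (hcl C hC y hy).trans (by linarith))
    (fun y hy s hs => (abs_sub _ _).trans
      (add_le_add (hcl C hC y hy.1) (htw s ⟨hs.1.le, hs.2⟩))) x hx t ht
  calc |f x t α| = |(f x t α - t * w α) + t * w α| := by rw [sub_add_cancel]
    _ ≤ |f x t α - t * w α| + |t * w α| := abs_add_le _ _
    _ ≤ C + 2 * |w α| * T := by linarith [htw t ht]
end
end

section
/- Let Ω ⊂ ℝⁿ be a nonempty bounded open set with diameter D, and let f : Ω̄ × [0,T) → ℝᵏ be a graphical translating mean curvature flow with initial–boundary data ψ and velocity vector w with |w^α| ≤ 1 for each α. Assume τ := sup_{Ω × [0,T)} |Df|² < ∞. Let ℓ(x) = ⟨x, b⟩ + c be an affine function with |b| = 1 and 0 ≤ ℓ ≤ D on Ω. Fix an index α and constants μ, K > 0 satisfying μK² / ((1+KD)²(1+τ)) ≥ n sup_Ω |D²ψ| + 1, where |D²ψ(x)| denotes the maximum over β of the operator norm of the Hessian matrix of ψ^β at x. Then the barrier Φ(x,t)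 := μ log(1 + Kℓ(x)) − f^α(x,t) + ψ^α(x) satisfies ∂_t Φ − Σ_{i,j} g^{ij} ∂_i∂_j Φ ≥ 0 on Ω × (0,T). -/
open Real MeasureTheory

noncomputable section

/-- The quadratic form of `1 + A Aᵀ`. -/
lemma dotProduct_one_add_mul_transpose_mulVec {n k : ℕ} (A : Matrix (Fin n) (Fin k) ℝ)
    (u v : Fin n → ℝ) :
    u ⬝ᵥ (1 + A * A.transpose).mulVec v = u ⬝ᵥ v + A.vecMul u ⬝ᵥ A.vecMul v := by
  rw [Matrix.add_mulVec, Matrix.one_mulVec, dotProduct_add, ← Matrix.mulVec_mulVec,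
    Matrix.dotProduct_mulVec, Matrix.mulVec_transpose]

lemma isUnit_one_add_mul_transpose {n k : ℕ} (A : Matrix (Fin n) (Fin k) ℝ) :
    IsUnit (1 + A * A.transpose) := by
  rw [← Matrix.mulVec_injective_iff_isUnit]
  refine (injective_iff_map_eq_zero (1 + A * A.transpose).mulVecLin).2 fun v hv => ?_
  have h := dotProduct_one_add_mul_transpose_mulVec A v v
  rw [Matrix.mulVecLin_apply] at hv
  rw [hv, dotProduct_zero] at h
  have h1 : 0 ≤ v ⬝ᵥ v := Fintype.sum_nonneg fun i => mul_self_nonneg _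
  have h2 : 0 ≤ A.vecMul v ⬝ᵥ A.vecMul v := Fintype.sum_nonneg fun i => mul_self_nonneg _
  exact dotProduct_self_eq_zero.1 (by linarith)

lemma transpose_inv_one_add_mul_transpose {n k : ℕ} (A : Matrix (Fin n) (Fin k) ℝ) :
    ((1 + A * A.transpose)⁻¹).transpose = (1 + A * A.transpose)⁻¹ := by
  rw [Matrix.transpose_nonsing_inv]
  simp

lemma mulVec_inv_one_add_mul_transpose {n k : ℕ} (A : Matrix (Fin n) (Fin k) ℝ)
    (v : Fin n → ℝ) :
    (1 + A * A.transpose).mulVec ((1 + A * A.transpose)⁻¹.mulVec v) = v := by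
  rw [Matrix.mulVec_mulVec, Matrix.mul_nonsing_inv _
    ((Matrix.isUnit_iff_isUnit_det _).1 (isUnit_one_add_mul_transpose A)), Matrix.one_mulVec]

/-- `(1 + A Aᵀ)⁻¹` is a contraction. -/
lemma inv_one_add_mul_transpose_mulVec_dotProduct_le {n k : ℕ} (A : Matrix (Fin n) (Fin k) ℝ)
    (v : Fin n → ℝ) :
    (1 + A * A.transpose)⁻¹.mulVec v ⬝ᵥ (1 + A * A.transpose)⁻¹.mulVec v ≤ v ⬝ᵥ v := by
  have h := dotProduct_one_add_mul_transpose_mulVec A ((1 + A * A.transpose)⁻¹.mulVec v)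
    ((1 + A * A.transpose)⁻¹.mulVec v)
  rw [mulVec_inv_one_add_mul_transpose] at h
  set y := (1 + A * A.transpose)⁻¹.mulVec v
  have h2 : 0 ≤ A.vecMul y ⬝ᵥ A.vecMul y := Fintype.sum_nonneg fun i => mul_self_nonneg _
  have h3 : 0 ≤ (y - v) ⬝ᵥ (y - v) := Fintype.sum_nonneg fun i => mul_self_nonneg _
  rw [sub_dotProduct, dotProduct_sub, dotProduct_sub, dotProduct_comm v y] at h3
  linarith

/-- Lower bound for the quadratic form of `(1 + A Aᵀ)⁻¹` in terms of the Frobenius norm of `A`. -/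
lemma one_div_le_dotProduct_inv_one_add_mul_transpose_mulVec {n k : ℕ}
    (A : Matrix (Fin n) (Fin k) ℝ) {τ : ℝ} (hτ : ∑ i, ∑ a, A i a ^ 2 ≤ τ)
    (b : Fin n → ℝ) (hb : ∑ i, b i ^ 2 = 1) :
    1 / (1 + τ) ≤ b ⬝ᵥ (1 + A * A.transpose)⁻¹.mulVec b := by
  have hτ0 : 0 ≤ τ := le_trans (by positivity) hτ
  have hbb : b ⬝ᵥ b = 1 := by simpa [dotProduct, sq] using hb
  have hGb : A.vecMul b ⬝ᵥ A.vecMul b ≤ τ := by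
    calc A.vecMul b ⬝ᵥ A.vecMul b = ∑ a, (∑ i, b i * A i a) ^ 2 := by
          simp [dotProduct, Matrix.vecMul, sq]
      _ ≤ ∑ a, (∑ i, b i ^ 2) * ∑ i, A i a ^ 2 :=
          Finset.sum_le_sum fun a _ => Finset.sum_mul_sq_le_sq_mul_sq _ _ _
      _ = ∑ i, ∑ a, A i a ^ 2 := by simp_rw [hb, one_mul]; exact Finset.sum_comm
      _ ≤ τ := hτ
  have hGy := mulVec_inv_one_add_mul_transpose A b
  set y := (1 + A * A.transpose)⁻¹.mulVec b
  set s := 1 / (1 + τ) with hs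
  have hs1 : s * (1 + τ) = 1 := by rw [hs]; field_simp
  have hs0 : 0 ≤ s := by positivity
  have h1 := dotProduct_one_add_mul_transpose_mulVec A y y
  have h2 := dotProduct_one_add_mul_transpose_mulVec A b y
  rw [hGy] at h1 h2
  have h3 : 0 ≤ (y - s • b) ⬝ᵥ (y - s • b) := Fintype.sum_nonneg fun i => mul_self_nonneg _
  have h4 : 0 ≤ (A.vecMul y - s • A.vecMul b) ⬝ᵥ (A.vecMul y - s • A.vecMul b) :=
    Fintype.sum_nonneg fun i => mul_self_nonneg _
  simp only [sub_dotProduct, dotProduct_sub, smul_dotProduct, dotProduct_smul, smul_eq_mul] at h3 h4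
  rw [dotProduct_comm y b] at h1 h3
  rw [dotProduct_comm (A.vecMul y) (A.vecMul b)] at h4
  rw [hbb] at h2 h3
  have h5 : s * (s * (A.vecMul b ⬝ᵥ A.vecMul b)) ≤ s * (s * τ) := by gcongr
  have h6 : s * (s * (1 + τ)) = s := by rw [hs1, mul_one]
  have h7 : s * (b ⬝ᵥ y) + s * (A.vecMul b ⬝ᵥ A.vecMul y) = s := by
    rw [← mul_add, ← h2, mul_one]
  nlinarith

/-- A matrix with operator norm at most `M` pairs with `(1 + A Aᵀ)⁻¹` to at most `n M`. -/
lemma sum_inv_one_add_mul_transpose_mul_le {n k : ℕ} (A : Matrix (Fin n) (Fin k) ℝ)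
    (H : Fin n → Fin n → ℝ) {M : ℝ} (hn : 1 ≤ n)
    (hH : ∀ ξ : Fin n → ℝ, Real.sqrt (∑ i, (∑ j, H i j * ξ j) ^ 2)
      ≤ M * Real.sqrt (∑ j, ξ j ^ 2)) :
    ∑ i, ∑ j, ((1 + A * A.transpose)⁻¹ : Matrix (Fin n) (Fin n) ℝ) i j * H i j ≤ n * M := by
  have hM : 0 ≤ M := by
    have h := hH (Pi.single ⟨0, hn⟩ 1)
    have h1 : ∑ j, (Pi.single (⟨0, hn⟩ : Fin n) (1 : ℝ) : Fin n → ℝ) j ^ 2 = 1 := by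
      simp [Pi.single_apply]
    rw [h1, Real.sqrt_one, mul_one] at h
    exact (Real.sqrt_nonneg _).trans h
  set P := (1 + A * A.transpose)⁻¹ with hP
  have hrow : ∀ i, ∑ j, P i j * H i j ≤ M := fun i => by
    have hPi : ∑ j, P i j ^ 2 ≤ 1 := by
      have h := inv_one_add_mul_transpose_mulVec_dotProduct_le A (Pi.single i 1)
      rw [← hP, Matrix.mulVec_single_one, single_dotProduct, one_mul, Pi.single_eq_same] at h
      have hPt : P.transpose = P := transpose_inv_one_add_mul_transpose A
      have h2 : ∀ j, P j i = P i j := fun j => congrFun (congrFun hPt i) j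
      simpa [dotProduct, h2, sq] using h
    calc ∑ j, P i j * H i j = ∑ j, H i j * P i j := by simp_rw [mul_comm]
      _ ≤ Real.sqrt (∑ i', (∑ j, H i' j * P i j) ^ 2) :=
          Real.le_sqrt_of_sq_le (Finset.single_le_sum
            (f := fun i' => (∑ j, H i' j * P i j) ^ 2) (fun _ _ => sq_nonneg _)
            (Finset.mem_univ i))
      _ ≤ M * Real.sqrt (∑ j, P i j ^ 2) := hH _
      _ ≤ M * 1 := by gcongr; exact Real.sqrt_le_one.2 hPi
      _ = M := mul_one M
  calc ∑ i, ∑ j, P i j * H i j ≤ ∑ _i : Fin n, M := Finset.sum_le_sum fun i _ => hrow i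
    _ = n * M := by simp

lemma ggr_eq_one_add_mul_transpose {n k : ℕ} (f : (Fin n → ℝ) → ℝ → (Fin k → ℝ)) (t : ℝ)
    (x : Fin n → ℝ) :
    ggr f t x = 1 + (Matrix.of fun i a => pd i (fun y => f y t a) x) *
      (Matrix.of fun i a => pd i (fun y => f y t a) x).transpose := by
  ext i j
  simp [ggr, Matrix.mul_apply, Matrix.one_apply]

lemma Filter.EventuallyEq.pd_eq {n : ℕ} {φ χ : (Fin n → ℝ) → ℝ} {x : Fin n → ℝ}
    (h : φ =ᶠ[nhds x] χ) (i : Fin n) : pd i φ x = pd i χ x := by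
  rw [pd, pd, h.fderiv_eq]

/-- Second partial derivatives of `u - v + w`. -/
lemma pd_pd_sub_add {n : ℕ} {u v w : (Fin n → ℝ) → ℝ} {x : Fin n → ℝ}
    (hu : ContDiffAt ℝ 2 u x) (hv : ContDiffAt ℝ 2 v x) (hw : ContDiffAt ℝ 2 w x)
    (i j : Fin n) :
    pd i (fun y => pd j (fun z => u z - v z + w z) y) x =
      pd i (fun y => pd j u y) x - pd i (fun y => pd j v y) x + pd i (fun y => pd j w y) x := by
  have hev : ∀ {p : (Fin n → ℝ) → ℝ}, ContDiffAt ℝ 2 p x →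
      ∀ᶠ y in nhds x, DifferentiableAt ℝ p y := fun hp =>
    (hp.eventually (by simp)).mono fun y hy => hy.differentiableAt (by simp)
  have hpd : ∀ {p : (Fin n → ℝ) → ℝ}, ContDiffAt ℝ 2 p x →
      DifferentiableAt ℝ (fun y => pd j p y) x := fun hp =>
    ((hp.fderiv_right (m := 1) (by norm_num)).differentiableAt (by simp)).clm_apply
      (differentiableAt_const _)
  have h1 : (fun y => pd j (fun z => u z - v z + w z) y) =ᶠ[nhds x]
      fun y => pd j u y - pd j v y + pd j w y := by
    filter_upwards [hev hu, hev hv, hev hw] with y hu hv hw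
    simp only [pd]
    rw [fderiv_fun_add (hu.fun_sub hv) hw, fderiv_fun_sub hu hv]
    simp
  rw [h1.pd_eq, pd, fderiv_fun_add ((hpd hu).fun_sub (hpd hv)) (hpd hw),
    fderiv_fun_sub (hpd hu) (hpd hv)]
  simp [pd]

lemma hasFDerivAt_affine {n : ℕ} (b : Fin n → ℝ) (c : ℝ) (x : Fin n → ℝ) :
    HasFDerivAt (fun x : Fin n → ℝ => (∑ i, x i * b i) + c)
      (∑ i, b i • ContinuousLinearMap.proj (R := ℝ) (φ := fun _ : Fin n => ℝ) i) x :=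
  (HasFDerivAt.fun_sum fun i _ => (hasFDerivAt_apply i x).mul_const (b i)).add_const c

/-- Second partial derivatives of `μ log (1 + K ℓ)` for an affine function `ℓ`. -/
lemma pd_pd_log_affine {n : ℕ} (b : Fin n → ℝ) (c μ K : ℝ) {x : Fin n → ℝ}
    (hx : 0 < 1 + K * ((∑ i, x i * b i) + c)) (i j : Fin n) :
    pd i (fun y => pd j (fun z => μ * Real.log (1 + K * ((∑ i, z i * b i) + c))) y) x =
      -(μ * K ^ 2 / (1 + K * ((∑ i, x i * b i) + c)) ^ 2) * (b i * b j) := by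
  have hL : ∀ y, HasFDerivAt (fun y : Fin n → ℝ => 1 + K * ((∑ i, y i * b i) + c))
      (K • ∑ i, b i • ContinuousLinearMap.proj (R := ℝ) (φ := fun _ : Fin n => ℝ) i) y := fun y =>
    ((hasFDerivAt_affine b c y).const_mul K).const_add 1
  have hs : ∀ i, (∑ l, b l • ContinuousLinearMap.proj (R := ℝ) (φ := fun _ : Fin n => ℝ) l)
      (Pi.single i 1) = b i := fun i => by
    simp [Pi.single_apply]
  have h1 : (fun y => pd j (fun z => μ * Real.log (1 + K * ((∑ i, z i * b i) + c))) y)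
      =ᶠ[nhds x] fun y => μ * K * b j * (1 + K * ((∑ i, y i * b i) + c))⁻¹ := by
    filter_upwards [(hL x).continuousAt.eventually (lt_mem_nhds hx)] with y hy
    rw [pd, (((hL y).log hy.ne').const_mul μ).fderiv]
    simp only [_root_.smul_apply, hs, smul_eq_mul]
    ring
  have hinv : HasFDerivAt (fun y : Fin n → ℝ => (1 + K * ((∑ i, y i * b i) + c))⁻¹) _ x :=
    (hasDerivAt_inv hx.ne').comp_hasFDerivAt x (hL x)
  rw [h1.pd_eq, pd, (hinv.const_mul (μ * K * b j)).fderiv]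
  simp only [_root_.smul_apply, hs, smul_eq_mul]
  ring

/-- The logarithmic barrier
`Φ(x,t) = μ log(1 + Kℓ(x)) − f^α(x,t) + ψ^α(x)` is a supersolution:
`∂_t Φ − Σ_{i,j} g^{ij} ∂_i∂_j Φ ≥ 0` on `Ω × (0,T)`. -/
theorem graph_flow_barrier {n k : ℕ} (hn : 1 ≤ n) (hk : 1 ≤ k)
    (Ω : Set (Fin n → ℝ)) (hΩo : IsOpen Ω) (hΩne : Ω.Nonempty)
    (hΩb : Bornology.IsBounded Ω)
    (D : ℝ) (hD : Metric.diam Ω = D) (T : ℝ) (hT : 0 < T)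
    (w : Fin k → ℝ) (hw : ∀ α, |w α| ≤ 1)
    (ψ : (Fin n → ℝ) → (Fin k → ℝ)) (hψ : ContDiffOn ℝ (⊤ : ℕ∞) ψ (closure Ω))
    (f : (Fin n → ℝ) → ℝ → (Fin k → ℝ)) (hflow : IsGraphFlow Ω T w ψ f)
    (τ : ℝ) (hτ : ∀ x ∈ Ω, ∀ t ∈ Set.Ico (0 : ℝ) T,
      ∑ i, ∑ a, (pd i (fun y => f y t a) x) ^ 2 ≤ τ)
    (b : Fin n → ℝ) (hb : ∑ i, (b i) ^ 2 = 1) (c : ℝ)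
    (ℓ : (Fin n → ℝ) → ℝ) (hℓ : ℓ = fun x => (∑ i, x i * b i) + c)
    (hℓ0 : ∀ x ∈ Ω, 0 ≤ ℓ x) (hℓD : ∀ x ∈ Ω, ℓ x ≤ D)
    (α : Fin k) (μ K : ℝ) (hμ : 0 < μ) (hK : 0 < K)
    (M2 : ℝ) (hM2 : ∀ β : Fin k, ∀ x ∈ Ω, ∀ ξ : Fin n → ℝ,
      Real.sqrt (∑ i, (∑ j, pd i (fun y => pd j (fun z => ψ z β) y) x * ξ j) ^ 2)
        ≤ M2 * Real.sqrt (∑ j, (ξ j) ^ 2))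
    (hkey : (n : ℝ) * M2 + 1 ≤ μ * K ^ 2 / ((1 + K * D) ^ 2 * (1 + τ)))
    (Φ : (Fin n → ℝ) → ℝ → ℝ)
    (hΦ : Φ = fun x t => μ * Real.log (1 + K * ℓ x) - f x t α + ψ x α) :
    ∀ x ∈ Ω, ∀ t ∈ Set.Ioo (0 : ℝ) T,
      0 ≤ deriv (fun s => Φ x s) t
          - ∑ i, ∑ j, (ggr f t x)⁻¹ i j * pd i (fun y => pd j (fun z => Φ z t) y) x := by
  intro x hx t ht
  obtain ⟨hfs, hpde, -, -⟩ := hflow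
  have hΩx : Ω ∈ nhds x := hΩo.mem_nhds hx
  have hfx : ContDiffAt ℝ 2 (fun z => f z t α) x := by
    have h1 : ContDiffAt ℝ (⊤ : ℕ∞) (fun p : (Fin n → ℝ) × ℝ => f p.1 p.2) (x, t) :=
      hfs.contDiffAt (prod_mem_nhds (Filter.mem_of_superset hΩx subset_closure)
        (Ico_mem_nhds ht.1 ht.2))
    have h2 : ContDiffAt ℝ (⊤ : ℕ∞) (fun z => f z t) x :=
      h1.comp x (contDiffAt_id.prodMk contDiffAt_const)
    exact (contDiffAt_pi.1 h2 α).of_le (by norm_cast)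
  have hψx : ContDiffAt ℝ 2 (fun z => ψ z α) x :=
    (contDiffAt_pi.1 (hψ.contDiffAt (Filter.mem_of_superset hΩx subset_closure)) α).of_le
      (by norm_cast)
  have hℓx := hℓ0 x hx
  have hℓDx := hℓD x hx
  subst hℓ
  have hpos : 0 < 1 + K * ((∑ i, x i * b i) + c) := by
    have := mul_nonneg hK.le hℓx
    linarith
  have hux : ContDiffAt ℝ 2
      (fun z : Fin n → ℝ => μ * Real.log (1 + K * ((∑ i, z i * b i) + c))) x :=
    contDiffAt_const.mul (ContDiffAt.log (by fun_prop) hpos.ne')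
  have hdt : deriv (fun s => Φ x s) t = -deriv (fun s => f x s α) t := by
    subst hΦ
    rw [deriv_add_const, deriv_const_sub]
  have hsecond : ∀ i j, pd i (fun y => pd j (fun z => Φ z t) y) x =
      -(μ * K ^ 2 / (1 + K * ((∑ i, x i * b i) + c)) ^ 2) * (b i * b j)
        - pd i (fun y => pd j (fun z => f z t α) y) x
        + pd i (fun y => pd j (fun z => ψ z α) y) x := fun i j => by
    subst hΦ
    rw [pd_pd_sub_add hux hfx hψx, pd_pd_log_affine b c μ K hpos]
  rw [hdt, hpde x hx t ht α]
  simp_rw [hsecond]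
  set A : Matrix (Fin n) (Fin k) ℝ := Matrix.of fun i a => pd i (fun y => f y t a) x with hA
  have hG : ggr f t x = 1 + A * A.transpose := ggr_eq_one_add_mul_transpose f t x
  rw [hG]
  have htr := sum_inv_one_add_mul_transpose_mul_le A
    (fun i j => pd i (fun y => pd j (fun z => ψ z α) y) x) hn (hM2 α x hx)
  have hAτ : ∑ i, ∑ a, A i a ^ 2 ≤ τ := hτ x hx t ⟨ht.1.le, ht.2⟩
  have hτ0 : 0 ≤ τ := le_trans (by positivity) hAτ
  have hq := one_div_le_dotProduct_inv_one_add_mul_transpose_mulVec A hAτ b hb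
  set P := (1 + A * A.transpose)⁻¹
  have hquad : ∑ i, ∑ j, P i j * (b i * b j) = b ⬝ᵥ P.mulVec b := by
    simp only [dotProduct, Matrix.mulVec, Finset.mul_sum]
    exact Finset.sum_congr rfl fun i _ => Finset.sum_congr rfl fun j _ => by ring
  set C := μ * K ^ 2 / (1 + K * ((∑ i, x i * b i) + c)) ^ 2 with hC
  have hsplit : ∑ i, ∑ j, P i j * (-C * (b i * b j)
        - pd i (fun y => pd j (fun z => f z t α) y) x
        + pd i (fun y => pd j (fun z => ψ z α) y) x) =
      -C * (b ⬝ᵥ P.mulVec b)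
        - ∑ i, ∑ j, P i j * pd i (fun y => pd j (fun z => f z t α) y) x
        + ∑ i, ∑ j, P i j * pd i (fun y => pd j (fun z => ψ z α) y) x := by
    rw [← hquad]
    simp only [Finset.mul_sum, ← Finset.sum_sub_distrib, ← Finset.sum_add_distrib]
    exact Finset.sum_congr rfl fun i _ => Finset.sum_congr rfl fun j _ => by ring
  rw [hsplit]
  have hmain : μ * K ^ 2 / ((1 + K * D) ^ 2 * (1 + τ)) ≤ C * (b ⬝ᵥ P.mulVec b) :=
    calc μ * K ^ 2 / ((1 + K * D) ^ 2 * (1 + τ))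
        = μ * K ^ 2 / (1 + K * D) ^ 2 * (1 / (1 + τ)) := by rw [div_mul_div_comm, mul_one]
      _ ≤ C * (b ⬝ᵥ P.mulVec b) := by rw [hC]; gcongr
  have hwα := (abs_le.1 (hw α)).2
  linarith
end
end
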